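/- Let α ∈ ℝ, α ≠ 0, and set E₁ := −exp(4π/α). If E ∈ ℝ with 0 < E < −E₁, then for every λ ∈ ℂ\{0}: d(k_E(λ)) := 1 − (α/(2π))·ln(|Re k_E(λ)| + |Im k_E(λ)|) = 0 if and only if |λ| = √(E/(−E₁)) or |λ| = √((−E₁)/E) (note 0 < E/(−E₁) < 1 < (−E₁)/E). Hence the Faddeev generalized scattering data a(k_E(λ)) = b(k_E(λ)) = (2π)⁻²·α/d(k_E(λ)) are singular in λ exactly on the two circles {|λ| = √(E/(−E₁))} ∪ {|λ| = √((−E₁)/E)}; in particular d(k_E(λ)) ≠ 0 in a neighborhood of the unit circle {|λ| = 1}. -/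

import Mathlib

/-- The principal square root of a real number, viewed in `ℂ`
(so `√E = i√(−E)` for `E < 0`). -/
noncomputable def sqrtC (E : ℝ) : ℂ := (E : ℂ) ^ (1/2 : ℂ)

/-- The rational parametrization `k_E(λ) = ((λ + λ⁻¹)√E/2, i(λ⁻¹ − λ)√E/2) ∈ ℂ²`
of the fixed-energy surface `{k ∈ ℂ² : k² = E}`. -/
noncomputable def kE (E : ℝ) (lam : ℂ) : ℂ × ℂ :=
  ((lam + lam⁻¹) * sqrtC E / 2, Complex.I * (lam⁻¹ - lam) * sqrtC E / 2)

/-- Euclidean norm `|Re k|` of the componentwise real part of `k ∈ ℂ²`. -/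
noncomputable def normRe (k : ℂ × ℂ) : ℝ := Real.sqrt (k.1.re ^ 2 + k.2.re ^ 2)

/-- Euclidean norm `|Im k|` of the componentwise imaginary part of `k ∈ ℂ²`. -/
noncomputable def normIm (k : ℂ × ℂ) : ℝ := Real.sqrt (k.1.im ^ 2 + k.2.im ^ 2)

/-- The denominator `d(k) = 1 − (α/2π)·ln(|Re k| + |Im k|)` of the Faddeev generalized
scattering data `a(k) = b(k) = (2π)⁻²·α/d(k)` of the 2D point potential of strength `α`. -/
noncomputable def dFad (α : ℝ) (k : ℂ × ℂ) : ℝ :=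
  1 - α / (2 * Real.pi) * Real.log (normRe k + normIm k)

theorem aux_sqrtC (E : ℝ) (hE : 0 < E) : sqrtC E = ((Real.sqrt E : ℝ) : ℂ) := by
  unfold sqrtC
  rw [Real.sqrt_eq_rpow, Complex.ofReal_cpow hE.le]
  norm_num

theorem aux_normRe (E : ℝ) (hE : 0 < E) (lam : ℂ) (hl : lam ≠ 0) :
    normRe (kE E lam) = Real.sqrt E * (‖lam‖ + ‖lam‖⁻¹) / 2 := by
  have hr : 0 < ‖lam‖ := norm_pos_iff.mpr hl
  have hs := Complex.sq_norm lam
  rw [Complex.normSq_apply] at hs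
  unfold normRe
  rw [Real.sqrt_eq_iff_mul_self_eq (by positivity) (by positivity), ← pow_two, div_pow, mul_pow]
  simp only [kE, aux_sqrtC E hE]
  simp [Complex.inv_re, Complex.inv_im, Complex.normSq_eq_norm_sq]
  field_simp
  linear_combination (-(‖lam‖ ^ 2 + 1) ^ 2) * hs

theorem aux_normIm (E : ℝ) (hE : 0 < E) (lam : ℂ) (hl : lam ≠ 0) :
    normIm (kE E lam) = Real.sqrt E * |‖lam‖ - ‖lam‖⁻¹| / 2 := by
  have hr : 0 < ‖lam‖ := norm_pos_iff.mpr hl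
  have hs := Complex.sq_norm lam
  rw [Complex.normSq_apply] at hs
  unfold normIm
  rw [Real.sqrt_eq_iff_mul_self_eq (by positivity) (by positivity)]
  rw [← pow_two, div_pow, mul_pow, sq_abs]
  simp only [kE, aux_sqrtC E hE]
  simp [Complex.inv_re, Complex.inv_im, Complex.normSq_eq_norm_sq]
  field_simp
  linear_combination (-(‖lam‖ ^ 2 - 1) ^ 2) * hs

theorem aux_sum (E : ℝ) (hE : 0 < E) (lam : ℂ) (hl : lam ≠ 0) :
    normRe (kE E lam) + normIm (kE E lam) = Real.sqrt E * max ‖lam‖ ‖lam‖⁻¹ := by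
  rw [aux_normRe E hE lam hl, aux_normIm E hE lam hl]
  rcases le_total ‖lam‖ ‖lam‖⁻¹ with h | h
  · rw [max_eq_right h, abs_of_nonpos (by linarith)]; ring
  · rw [max_eq_left h, abs_of_nonneg (by linarith)]; ring

theorem aux_iff (α : ℝ) (hα : α ≠ 0) (E : ℝ)
    (hE₀ : 0 < E) (hE₁ : E < Real.exp (4 * Real.pi / α)) (lam : ℂ) (hl : lam ≠ 0) :
      (dFad α (kE E lam) = 0 ↔
        ‖lam‖ = Real.sqrt (E / Real.exp (4 * Real.pi / α)) ∨
        ‖lam‖ = Real.sqrt (Real.exp (4 * Real.pi / α) / E)) := by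
  have hr : 0 < ‖lam‖ := norm_pos_iff.mpr hl
  have hpi := Real.pi_pos
  have hsE : 0 < Real.sqrt E := Real.sqrt_pos.mpr hE₀
  set s := Real.exp (2 * Real.pi / α) with hsdef
  have hs : 0 < s := Real.exp_pos _
  have hss : Real.exp (4 * Real.pi / α) = s ^ 2 := by
    rw [hsdef, ← Real.exp_nat_mul]; congr 1; push_cast; ring
  have hlt : Real.sqrt E < s := by
    rw [Real.sqrt_lt' hs, ← hss]; exact hE₁
  have hM : 0 < Real.sqrt E * max ‖lam‖ ‖lam‖⁻¹ := by positivity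
  have h1 : dFad α (kE E lam) = 0 ↔ Real.sqrt E * max ‖lam‖ ‖lam‖⁻¹ = s := by
    unfold dFad
    rw [aux_sum E hE₀ lam hl]
    constructor
    · intro h
      have : Real.log (Real.sqrt E * max ‖lam‖ ‖lam‖⁻¹) = 2 * Real.pi / α := by
        field_simp at h ⊢
        linarith
      rw [hsdef, ← this, Real.exp_log hM]
    · intro h
      rw [h, hsdef, Real.log_exp]
      field_simp
      norm_num
  rw [h1, hss, Real.sqrt_div hE₀.le, Real.sqrt_div (by positivity), Real.sqrt_sq hs.le]
  generalize Real.sqrt E = q at *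
  generalize ‖lam‖ = r at *
  rw [eq_div_iff hs.ne', eq_div_iff hsE.ne']
  constructor
  · intro h
    rcases le_total r r⁻¹ with h' | h'
    · left
      rw [max_eq_right h'] at h
      rw [← h]; field_simp
    · right
      rw [max_eq_left h'] at h
      linarith
  · rintro (h | h)
    · have h2 : r ≤ 1 := by nlinarith
      rw [max_eq_right (h2.trans (one_le_inv_iff₀.mpr ⟨hr, h2⟩)), ← h]
      field_simp
    · have h2 : 1 ≤ r := by nlinarith
      rw [max_eq_left ((inv_le_one_of_one_le₀ h2).trans h2)]
      linarith

/-- Let `α ≠ 0`, `E₁ := −exp(4π/α)`, and `0 < E < −E₁`. Then for every `λ ∈ ℂ\{0}`: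
`d(k_E(λ)) = 0 ↔ |λ| = √(E/(−E₁))` or `|λ| = √((−E₁)/E)`; hence the Faddeev generalized
scattering data `(2π)⁻²·α/d(k_E(λ))` are singular exactly on these two circles; in
particular `d(k_E(λ)) ≠ 0` in a neighborhood of the unit circle `{|λ| = 1}`. -/
theorem point_potential_data_contour_singularities_small_positive_energy
    (α : ℝ) (hα : α ≠ 0) (E : ℝ)
    (hE₀ : 0 < E) (hE₁ : E < Real.exp (4 * Real.pi / α)) :
    (∀ lam : ℂ, lam ≠ 0 →
      (dFad α (kE E lam) = 0 ↔
        ‖lam‖ = Real.sqrt (E / Real.exp (4 * Real.pi / α)) ∨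
        ‖lam‖ = Real.sqrt (Real.exp (4 * Real.pi / α) / E))) ∧
    ∃ η > (0:ℝ), ∀ lam : ℂ, lam ≠ 0 → |‖lam‖ - 1| < η → dFad α (kE E lam) ≠ 0 := by
  refine ⟨fun lam hl => aux_iff α hα E hE₀ hE₁ lam hl, ?_⟩
  have hx := Real.exp_pos (4 * Real.pi / α)
  have ha : Real.sqrt (E / Real.exp (4 * Real.pi / α)) ≠ 1 := by
    rw [Ne, Real.sqrt_eq_one, div_eq_one_iff_eq hx.ne']; exact hE₁.ne
  have hb : Real.sqrt (Real.exp (4 * Real.pi / α) / E) ≠ 1 := by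
    rw [Ne, Real.sqrt_eq_one, div_eq_one_iff_eq hE₀.ne']; exact hE₁.ne'
  refine ⟨min _ _, lt_min (abs_pos.mpr (sub_ne_zero.mpr ha)) (abs_pos.mpr (sub_ne_zero.mpr hb)),
    fun lam hl hlt h => ?_⟩
  rcases (aux_iff α hα E hE₀ hE₁ lam hl).mp h with h | h
  · rw [h] at hlt
    exact lt_irrefl _ (hlt.trans_le (min_le_left _ _))
  · rw [h] at hlt
    exact lt_irrefl _ (hlt.trans_le (min_le_right _ _))
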